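/- Let F be a field of characteristic not dividing 6 and let γ ⊆ P²_F be a geometrically irreducible plane cubic curve with a non-smooth F-rational point R. Then for any point S ∈ P²(F), the set of F-points t of γ such that the line joining S and t is tangent to γ at t has cardinality at most 6. -/

import Mathlib

open MvPolynomial

section LinearSubstitution

variable {n : Type*} [Fintype n] {K : Type*}

theorem bind₁_toMvPolynomial_irreducible [DecidableEq n] [Field K] {M : Matrix n n K}
    (hM : IsUnit M.det) {f : MvPolynomial n K} (hf : Irreducible f) :
    Irreducible (bind₁ M.toMvPolynomial f) := by
  have key : ∀ A B : Matrix n n K, A * B = 1 →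
      (bind₁ B.toMvPolynomial).comp (bind₁ A.toMvPolynomial) = AlgHom.id K _ := by
    intro A B h
    ext1 i
    simp [← Matrix.toMvPolynomial_mul, h]
  let e : MvPolynomial n K ≃ₐ[K] MvPolynomial n K :=
    AlgEquiv.ofAlgHom (bind₁ M.toMvPolynomial) (bind₁ M⁻¹.toMvPolynomial)
      (key _ _ (Matrix.nonsing_inv_mul M hM)) (key _ _ (Matrix.mul_nonsing_inv M hM))
  exact (MulEquiv.irreducible_iff e).2 hf

theorem eval_bind₁_toMvPolynomial [CommRing K] (M : Matrix n n K) (f : MvPolynomial n K)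
    (w : n → K) : eval w (bind₁ M.toMvPolynomial f) = eval (M.mulVec w) f := by
  rw [← coe_aeval_eq_eval, ← coe_aeval_eq_eval, RingHom.coe_coe, RingHom.coe_coe, aeval_bind₁]
  congr 2
  ext i
  exact Matrix.toMvPolynomial_eval_eq_apply M i w

theorem pderiv_toMvPolynomial [DecidableEq n] [CommRing K] (M : Matrix n n K) (i j : n) :
    pderiv j (M.toMvPolynomial i) = C (M i j) := by
  simp only [Matrix.toMvPolynomial, ← C_mul_X_eq_monomial, map_sum, pderiv_C_mul, pderiv_X]
  rw [Finset.sum_eq_single j]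
  · simp
  · intro b _ hb
    simp [Pi.single_eq_of_ne hb]
  · simp

theorem pderiv_bind₁_toMvPolynomial [DecidableEq n] [CommRing K] (M : Matrix n n K)
    (f : MvPolynomial n K) (j : n) :
    pderiv j (bind₁ M.toMvPolynomial f) =
      ∑ i, C (M i j) * bind₁ M.toMvPolynomial (pderiv i f) := by
  induction f using MvPolynomial.induction_on with
  | C a => simp
  | add p q hp hq => simp [hp, hq, mul_add, Finset.sum_add_distrib]
  | mul_X p k hp =>
    have hk : ∑ i, C (M i j) * (bind₁ M.toMvPolynomial p *
        bind₁ M.toMvPolynomial (pderiv i (X k))) = bind₁ M.toMvPolynomial p * C (M k j) := by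
      rw [Finset.sum_eq_single k]
      · rw [pderiv_X_self, map_one, mul_one, mul_comm]
      · intro b _ hb
        rw [pderiv_X_of_ne hb.symm, map_zero, mul_zero, mul_zero]
      · simp
    simp only [map_mul, Derivation.leibniz, hp, bind₁_X_right, pderiv_toMvPolynomial,
      smul_eq_mul, map_add, mul_add, Finset.sum_add_distrib, hk, Finset.mul_sum]
    exact congrArg _ (Finset.sum_congr rfl fun _ _ => mul_left_comm _ _ _)

theorem eval_pderiv_bind₁_toMvPolynomial [DecidableEq n] [CommRing K] (M : Matrix n n K)
    (f : MvPolynomial n K) (j : n) (w : n → K) :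
    eval w (pderiv j (bind₁ M.toMvPolynomial f)) =
      ∑ i, M i j * eval (M.mulVec w) (pderiv i f) := by
  simp [pderiv_bind₁_toMvPolynomial, eval_bind₁_toMvPolynomial]

end LinearSubstitution

/-- The binary quadratic form with coefficients `q`. -/
def binaryQuadratic {A : Type*} [CommRing A] (q : Fin 3 → A) (x y : A) : A :=
  q 0 * x ^ 2 + q 1 * x * y + q 2 * y ^ 2

/-- The binary cubic form with coefficients `c`. -/
def binaryCubic {A : Type*} [CommRing A] (c : Fin 4 → A) (x y : A) : A :=
  c 0 * x ^ 3 + c 1 * x ^ 2 * y + c 2 * x * y ^ 2 + c 3 * y ^ 3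

/-- The ternary cubic form `z q(x, y) + c(x, y)`, singular at `(0 : 0 : 1)`. -/
noncomputable def singularCubic {A : Type*} [CommRing A] (q : Fin 3 → A) (c : Fin 4 → A) :
    MvPolynomial (Fin 3) A :=
  X 2 * binaryQuadratic (fun i => C (q i)) (X 0) (X 1) +
    binaryCubic (fun i => C (c i)) (X 0) (X 1)

section SingularCubic

variable {K : Type*}

theorem map_singularCubic {A B : Type*} [CommRing A] [CommRing B] (f : A →+* B)
    (q : Fin 3 → A) (c : Fin 4 → A) :
    map f (singularCubic q c) = singularCubic (fun i => f (q i)) (fun i => f (c i)) := by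
  simp [singularCubic, binaryQuadratic, binaryCubic]

theorem eval_singularCubic [CommRing K] (q : Fin 3 → K) (c : Fin 4 → K) (w : Fin 3 → K) :
    eval w (singularCubic q c) =
      w 2 * binaryQuadratic q (w 0) (w 1) + binaryCubic c (w 0) (w 1) := by
  simp [singularCubic, binaryQuadratic, binaryCubic]

theorem eval_pderiv_zero_singularCubic [CommRing K] (q : Fin 3 → K) (c : Fin 4 → K)
    (w : Fin 3 → K) :
    eval w (pderiv 0 (singularCubic q c)) =
      w 2 * (2 * q 0 * w 0 + q 1 * w 1) +
        (3 * c 0 * w 0 ^ 2 + 2 * c 1 * w 0 * w 1 + c 2 * w 1 ^ 2) := by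
  simp [singularCubic, binaryQuadratic, binaryCubic, pderiv_X, Derivation.leibniz_pow]
  ring

theorem eval_pderiv_two_singularCubic [CommRing K] (q : Fin 3 → K) (c : Fin 4 → K)
    (w : Fin 3 → K) :
    eval w (pderiv 2 (singularCubic q c)) = binaryQuadratic q (w 0) (w 1) := by
  simp [singularCubic, binaryQuadratic, binaryCubic, pderiv_X, Derivation.leibniz_pow]

theorem MvPolynomial.IsHomogeneous.exists_ternary_cubic [CommRing K] {f : MvPolynomial (Fin 3) K}
    (hf : f.IsHomogeneous 3) :
    ∃ (q : Fin 3 → K) (c : Fin 4 → K) (a b d : K), f = singularCubic q c +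
      (C a * X 2 ^ 3 + C b * X 2 ^ 2 * X 0 + C d * X 2 ^ 2 * X 1) := by
  rw [f.as_sum]
  refine Finset.sum_induction _ (fun f => ∃ (q : Fin 3 → K) (c : Fin 4 → K) (a b d : K),
    f = singularCubic q c + (C a * X 2 ^ 3 + C b * X 2 ^ 2 * X 0 + C d * X 2 ^ 2 * X 1))
    ?_ ?_ ?_
  · rintro _ _ ⟨q, c, a, b, d, rfl⟩ ⟨q', c', a', b', d', rfl⟩
    refine ⟨q + q', c + c', a + a', b + b', d + d', ?_⟩
    simp only [singularCubic, binaryQuadratic, binaryCubic, Pi.add_apply, C_add]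
    ring
  · exact ⟨0, 0, 0, 0, 0, by simp [singularCubic, binaryQuadratic, binaryCubic]⟩
  · intro m hm
    have hdeg : m 0 + m 1 + m 2 = 3 := by
      have := hf (mem_support_iff.1 hm)
      rw [Finsupp.weight_apply, Finsupp.sum_fintype _ _ (by simp)] at this
      simpa [Fin.sum_univ_three] using this
    rw [monomial_eq, Finsupp.prod_fintype _ _ (by simp), Fin.prod_univ_three]
    generalize coeff m f = r
    have h2 : m 2 = 3 - m 0 - m 1 := by omega
    have h0 : m 0 ≤ 3 := by omega
    have h1 : m 1 ≤ 3 - m 0 := by omega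
    rw [h2]
    refine ⟨fun i => if m 0 + i = 2 ∧ m 1 = i then r else 0,
      fun i => if m 0 + i = 3 ∧ m 1 = i then r else 0,
      if m 0 = 0 ∧ m 1 = 0 then r else 0, if m 0 = 1 ∧ m 1 = 0 then r else 0,
      if m 0 = 0 ∧ m 1 = 1 then r else 0, ?_⟩
    clear hdeg h2
    generalize m 0 = i at *
    generalize m 1 = j at *
    interval_cases i <;> interval_cases j <;>
      simp [singularCubic, binaryQuadratic, binaryCubic] <;> ring

theorem MvPolynomial.IsHomogeneous.exists_eq_singularCubic [CommRing K]
    {f : MvPolynomial (Fin 3) K} (hf : f.IsHomogeneous 3) (h0 : eval ![0, 0, 1] f = 0)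
    (hsing : ∀ j, eval ![0, 0, 1] (pderiv j f) = 0) :
    ∃ q c, f = singularCubic q c := by
  obtain ⟨q, c, a, b, d, rfl⟩ := hf.exists_ternary_cubic
  refine ⟨q, c, ?_⟩
  have ha : a = 0 := by
    simpa [eval_singularCubic, binaryQuadratic, binaryCubic] using h0
  have hb : b = 0 := by
    simpa [singularCubic, binaryQuadratic, binaryCubic, pderiv_X, Derivation.leibniz_pow,
      Pi.single_apply] using hsing 0
  have hd : d = 0 := by
    simpa [singularCubic, binaryQuadratic, binaryCubic, pderiv_X, Derivation.leibniz_pow,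
      Pi.single_apply] using hsing 1
  simp [ha, hb, hd]

theorem eq_zero_of_irreducible_singularCubic [Field K] {q : Fin 3 → K} {c : Fin 4 → K}
    (h : Irreducible (singularCubic q c)) {x y : K} (hq : binaryQuadratic q x y = 0)
    (hc : binaryCubic c x y = 0) : x = 0 ∧ y = 0 := by
  by_contra hxy
  suffices H : ∃ l m : MvPolynomial (Fin 3) K, singularCubic q c = l * m ∧
      (∃ v, eval v l = 0) ∧ ∃ v, eval v m = 0 by
    obtain ⟨l, m, hlm, ⟨v, hv⟩, ⟨w, hw⟩⟩ := H
    rcases h.isUnit_or_isUnit hlm with hu | hu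
    · exact (hu.map (eval v)).ne_zero hv
    · exact (hu.map (eval w)).ne_zero hw
  unfold binaryQuadratic at hq
  unfold binaryCubic at hc
  by_cases hy : y = 0
  · subst hy
    have hx : x ≠ 0 := by simpa using hxy
    have hq0 : q 0 = 0 := by simpa [hx] using hq
    have hc0 : c 0 = 0 := by simpa [hx] using hc
    refine ⟨X 1, X 2 * (C (q 1) * X 0 + C (q 2) * X 1) + C (c 1) * X 0 ^ 2 +
      C (c 2) * X 0 * X 1 + C (c 3) * X 1 ^ 2, ?_, ⟨0, by simp⟩, ⟨0, by simp⟩⟩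
    simp only [singularCubic, binaryQuadratic, binaryCubic, hq0, hc0, C_0]
    ring
  · obtain ⟨t, rfl⟩ : ∃ t, x = t * y := ⟨x / y, by field_simp⟩
    have hq2 : q 2 = -(q 0 * t ^ 2 + q 1 * t) := by
      have : y ^ 2 ≠ 0 := pow_ne_zero _ hy
      apply mul_right_cancel₀ this
      linear_combination hq
    have hc3 : c 3 = -(c 0 * t ^ 3 + c 1 * t ^ 2 + c 2 * t) := by
      have : y ^ 3 ≠ 0 := pow_ne_zero _ hy
      apply mul_right_cancel₀ this
      linear_combination hc
    refine ⟨X 0 - C t * X 1, X 2 * (C (q 0) * X 0 + (C (q 0) * C t + C (q 1)) * X 1) +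
      C (c 0) * X 0 ^ 2 + (C (c 0) * C t + C (c 1)) * X 0 * X 1 +
      (C (c 0) * C t ^ 2 + C (c 1) * C t + C (c 2)) * X 1 ^ 2, ?_, ⟨0, by simp⟩, ⟨0, by simp⟩⟩
    simp only [singularCubic, binaryQuadratic, binaryCubic, hq2, hc3, C_neg, C_add, C_mul, C_pow]
    ring

/-- The coefficients of the binary quartic `q ∂c/∂x - c ∂q/∂x`. -/
def polarQuartic {A : Type*} [CommRing A] (q : Fin 3 → A) (c : Fin 4 → A) : Fin 5 → A :=
  ![q 2 * c 2 - q 1 * c 3, 2 * (q 2 * c 1 - q 0 * c 3),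
    q 1 * c 1 - q 0 * c 2 + 3 * (q 2 * c 0), 2 * (q 1 * c 0), q 0 * c 0]

theorem map_polarQuartic {A B : Type*} [CommRing A] [CommRing B] (f : A →+* B)
    (q : Fin 3 → A) (c : Fin 4 → A) (i : Fin 5) :
    polarQuartic (fun i => f (q i)) (fun i => f (c i)) i = f (polarQuartic q c i) := by
  fin_cases i <;> simp [polarQuartic, map_ofNat f 2, map_ofNat f 3]

theorem exists_common_zero_of_polarQuartic_eq_zero [Field K] [IsAlgClosed K] (h2 : (2 : K) ≠ 0)
    (h3 : (3 : K) ≠ 0) {q : Fin 3 → K} {c : Fin 4 → K} (h : polarQuartic q c = 0) :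
    ∃ x y, binaryQuadratic q x y = 0 ∧ binaryCubic c x y = 0 ∧ ¬(x = 0 ∧ y = 0) := by
  have e0 : q 2 * c 2 - q 1 * c 3 = 0 := congrFun h 0
  have e1 : 2 * (q 2 * c 1 - q 0 * c 3) = 0 := congrFun h 1
  have e2 : q 1 * c 1 - q 0 * c 2 + 3 * (q 2 * c 0) = 0 := congrFun h 2
  have e3 : 2 * (q 1 * c 0) = 0 := congrFun h 3
  have e4 : q 0 * c 0 = 0 := congrFun h 4
  by_cases hc0 : c 0 = 0
  · by_cases hq0 : q 0 = 0
    · exact ⟨1, 0, by simp [binaryQuadratic, hq0], by simp [binaryCubic, hc0], by simp⟩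
    · obtain ⟨s, hs⟩ := IsAlgClosed.exists_pow_nat_eq (discrim (q 0) (q 1) (q 2)) two_pos
      have : NeZero (2 : K) := ⟨h2⟩
      obtain ⟨t, ht⟩ := exists_quadratic_eq_zero hq0 ⟨s, by rw [← hs, sq]⟩
      refine ⟨t, 1, by rw [binaryQuadratic]; linear_combination ht, ?_, by simp⟩
      have e1' := (mul_eq_zero.1 e1).resolve_left h2
      apply mul_left_cancel₀ hq0
      simp only [binaryCubic, hc0] at e2 ⊢
      linear_combination c 1 * ht - t * e2 - e1'
  · have hq0 : q 0 = 0 := by simpa [hc0] using e4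
    have hq1 : q 1 = 0 := by simpa [hc0, h2] using e3
    have hq2 : q 2 = 0 := by simpa [hc0, h3, hq0, hq1] using e2
    let p : Cubic K := ⟨c 0, c 1, c 2, c 3⟩
    obtain ⟨t, ht⟩ := IsAlgClosed.exists_root p.toPoly
      (by rw [Cubic.degree_of_a_ne_zero hc0]; decide)
    refine ⟨t, 1, by simp [binaryQuadratic, hq0, hq1, hq2], ?_, by simp⟩
    simpa [p, Cubic.toPoly, binaryCubic] using ht

/-- The points of a singular cubic whose tangent passes through `(1 : 0 : 0)` are represented, up
to scaling, by at most six vectors. -/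
theorem exists_finset_of_polarQuartic_ne_zero [Field K] [DecidableEq K] {q : Fin 3 → K}
    {c : Fin 4 → K}
    (hqc : ∀ x y, binaryQuadratic q x y = 0 → binaryCubic c x y = 0 → x = 0 ∧ y = 0)
    (hG : polarQuartic q c ≠ 0) :
    ∃ T : Finset (Fin 3 → K), T.card ≤ 6 ∧ ∀ w : Fin 3 → K, eval w (singularCubic q c) = 0 →
      eval w (pderiv 0 (singularCubic q c)) = 0 → ∃ a ∈ T, ∃ k : K, w = k • a := by
  let G := polarQuartic q c
  let g : Polynomial K := ∑ i : Fin 5, Polynomial.C (G i) * Polynomial.X ^ (i : ℕ)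
  have hg : g ≠ 0 := by
    contrapose! hG
    ext i
    have := congrArg (Polynomial.coeff · i) hG
    simpa [g, G, Polynomial.finsetSum_coeff, Polynomial.coeff_X_pow, Fin.val_inj] using this
  have hdeg : g.natDegree ≤ 4 := by
    refine Polynomial.natDegree_sum_le_of_forall_le _ _ fun i _ => ?_
    exact (Polynomial.natDegree_C_mul_X_pow_le _ _).trans (by omega)
  let pt : K → Fin 3 → K := fun t =>
    ![t * binaryQuadratic q t 1, binaryQuadratic q t 1, -binaryCubic c t 1]
  refine ⟨insert ![0, 0, 1] (insert ![q 0, 0, -c 0] (g.roots.toFinset.image pt)), ?_, ?_⟩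
  · have h1 := g.roots.toFinset_card_le
    have h2 := g.card_roots'
    have h3 := Finset.card_image_le (s := g.roots.toFinset) (f := pt)
    have h4 := Finset.card_insert_le ![q 0, 0, -c 0] (g.roots.toFinset.image pt)
    have h5 := Finset.card_insert_le ![0, 0, 1]
      (insert ![q 0, 0, -c 0] (g.roots.toFinset.image pt))
    omega
  · intro w hw hw'
    rw [eval_singularCubic] at hw
    rw [eval_pderiv_zero_singularCubic] at hw'
    generalize hx : w 0 = x at *
    generalize hy : w 1 = y at *
    generalize hz : w 2 = z at *
    have hwe : w = ![x, y, z] := by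
      ext i
      fin_cases i <;> simp [hx, hy, hz]
    by_cases hy0 : y = 0
    · by_cases hx0 : x = 0
      · exact ⟨_, Finset.mem_insert_self _ _, z, by simp [hwe, hx0, hy0]⟩
      · have hq0 : q 0 ≠ 0 := by
          intro h0
          refine hx0 (hqc x y (by simp [binaryQuadratic, h0, hy0]) ?_).1
          simpa [binaryQuadratic, h0, hy0] using hw
        have hzx : z * q 0 = -(x * c 0) := by
          have : x ^ 2 ≠ 0 := pow_ne_zero _ hx0
          apply mul_right_cancel₀ this
          simp only [hy0, binaryQuadratic, binaryCubic] at hw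
          linear_combination hw
        refine ⟨_, Finset.mem_insert_of_mem (Finset.mem_insert_self _ _), x / q 0, ?_⟩
        ext i
        fin_cases i
        · simp [hwe, hq0]
        · simp [hwe, hy0]
        · simp [hwe]
          field_simp
          linear_combination hzx
    · obtain ⟨t, rfl⟩ : ∃ t, x = t * y := ⟨x / y, by field_simp⟩
      have hzq : z * binaryQuadratic q t 1 = -(y * binaryCubic c t 1) := by
        have : y ^ 2 ≠ 0 := pow_ne_zero _ hy0
        apply mul_right_cancel₀ this
        simp only [binaryQuadratic, binaryCubic] at hw ⊢
        linear_combination hw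
      have hqt : binaryQuadratic q t 1 ≠ 0 := by
        intro h0
        refine one_ne_zero (hqc t 1 h0 ?_).2
        simpa [h0, hy0] using hzq
      have hroot : t ∈ g.roots := by
        rw [Polynomial.mem_roots hg, Polynomial.IsRoot]
        have : y ^ 4 ≠ 0 := pow_ne_zero _ hy0
        apply mul_right_cancel₀ this
        rw [zero_mul]
        simp only [binaryQuadratic, binaryCubic] at hw hw'
        have hval : g.eval t = q 2 * c 2 - q 1 * c 3 + 2 * (q 2 * c 1 - q 0 * c 3) * t +
            (q 1 * c 1 - q 0 * c 2 + 3 * (q 2 * c 0)) * t ^ 2 + 2 * (q 1 * c 0) * t ^ 3 +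
            q 0 * c 0 * t ^ 4 := by
          simp [g, G, polarQuartic, Fin.sum_univ_five]
        rw [hval]
        linear_combination (q 0 * t ^ 2 * y ^ 2 + q 1 * t * y ^ 2 + q 2 * y ^ 2) * hw' -
          (2 * q 0 * t * y + q 1 * y) * hw
      refine ⟨pt t, ?_, y / binaryQuadratic q t 1, ?_⟩
      · simp only [Finset.mem_insert, Finset.mem_image, Multiset.mem_toFinset]
        exact Or.inr (Or.inr ⟨t, hroot, rfl⟩)
      · ext i
        fin_cases i
        · simp [hwe, pt]
          field_simp
        · simp [hwe, pt, hqt]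
        · simp [hwe, pt]
          field_simp
          linear_combination hzq

end SingularCubic

theorem Projectivization.ncard_le_of_forall_mem_smul {K V : Type*} [Field K] [AddCommGroup V]
    [Module K V] {X : Set (Projectivization K V)} {T : Finset V} {n : ℕ} (hT : T.card ≤ n)
    (h : ∀ x ∈ X, ∃ a ∈ T, ∃ k : K, x.rep = k • a) : X.Finite ∧ X.ncard ≤ n := by
  classical
  by_cases hX : X.Nonempty
  · obtain ⟨x₀, -⟩ := hX
    let P : V → Projectivization K V := fun a => if ha : a ≠ 0 then mk K a ha else x₀
    have hsub : X ⊆ (T.image P : Finset _) := by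
      intro x hx
      obtain ⟨a, ha, k, hk⟩ := h x hx
      have ha0 : a ≠ 0 := by
        rintro rfl
        exact x.rep_nonzero (by simpa using hk)
      refine Finset.mem_coe.2 (Finset.mem_image.2 ⟨a, ha, ?_⟩)
      simp only [P, dif_pos ha0]
      rw [← x.mk_rep, eq_comm, mk_eq_mk_iff']
      exact ⟨k, hk.symm⟩
    refine ⟨(Finset.finite_toSet _).subset hsub, ?_⟩
    refine (Set.ncard_le_ncard hsub (Finset.finite_toSet _)).trans ?_
    rw [Set.ncard_coe_finset]
    exact Finset.card_image_le.trans hT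
  · rw [Set.not_nonempty_iff_eq_empty] at hX
    simp [hX]

/-- A matrix whose last column is `R` and whose first column is `S`, unless `S` is proportional
to `R`. -/
theorem exists_frame {K : Type*} [Field K] {R : Fin 3 → K} (hR : R ≠ 0) (S : Fin 3 → K) :
    ∃ M : Matrix (Fin 3) (Fin 3) K, IsUnit M.det ∧ (∀ i, M i 2 = R i) ∧
      ((∀ i, M i 0 = S i) ∨ ∃ s : K, S = s • R) := by
  have key : ∀ A : Fin 3 → K, (¬∃ s : K, A = s • R) →
      ∃ M : Matrix (Fin 3) (Fin 3) K, IsUnit M.det ∧ (∀ i, M i 2 = R i) ∧ ∀ i, M i 0 = A i := by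
    intro A hA
    have hli : LinearIndependent K ![R, A] := by
      rw [LinearIndependent.pair_iff' hR]
      exact fun s hs => hA ⟨s, hs.symm⟩
    have hcr := crossProduct_ne_zero_iff_linearIndependent.2 hli
    obtain ⟨i, hi⟩ := Function.ne_iff.1 hcr
    refine ⟨(Matrix.of ![A, Pi.single i 1, R]).transpose, ?_, fun _ => rfl, fun _ => rfl⟩
    rw [isUnit_iff_ne_zero, Matrix.det_transpose]
    have : (Matrix.of ![A, Pi.single i 1, R]).det = crossProduct R A i := by
      change Matrix.det ![A, Pi.single i 1, R] = _
      rw [← triple_product_eq_det, triple_product_permutation, single_dotProduct, one_mul]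
    rwa [this]
  by_cases hS : ∃ s : K, S = s • R
  · have : ∃ A : Fin 3 → K, ¬∃ s : K, A = s • R := by
      by_contra! H
      obtain ⟨s, hs⟩ := H (Pi.single 0 1)
      obtain ⟨r, hr⟩ := H (Pi.single 1 1)
      have h0 := congrFun hs 0
      have h1 := congrFun hs 1
      have h2 := congrFun hr 1
      simp at h0 h1 h2
      rcases h1 with h1 | h1 <;> simp [h1] at h0 h2
    obtain ⟨A, hA⟩ := this
    obtain ⟨M, h1, h2, -⟩ := key A hA
    exact ⟨M, h1, h2, Or.inr hS⟩
  · obtain ⟨M, h1, h2, h3⟩ := key S hS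
    exact ⟨M, h1, h2, Or.inl h3⟩

/-- Let `F` be a field of characteristic not dividing 6 and `γ ⊆ P²_F` a
geometrically irreducible plane cubic curve (cut out by `φ`) with a non-smooth
`F`-rational point `R`. For any `S ∈ P²(F)`, the set of `F`-points `t` of `γ`
at which the line `St` is tangent to `γ` (i.e. the polar of `S` vanishes at
`t`) has cardinality at most 6. -/
theorem stmt_5 (F : Type) [Field F] (h2 : (2 : F) ≠ 0) (h3 : (3 : F) ≠ 0)
    (φ : MvPolynomial (Fin 3) F) (hφ : φ.IsHomogeneous 3)
    (hirr : Irreducible (MvPolynomial.map (algebraMap F (AlgebraicClosure F)) φ))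
    (R : Fin 3 → F) (hR : R ≠ 0) (hRγ : MvPolynomial.eval R φ = 0)
    (hRsing : ∀ i : Fin 3, MvPolynomial.eval R (MvPolynomial.pderiv i φ) = 0)
    (S : Fin 3 → F) (hS : S ≠ 0) :
    {x : Projectivization F (Fin 3 → F) | ∃ (v : Fin 3 → F) (hv : v ≠ 0),
        x = Projectivization.mk F v hv ∧ MvPolynomial.eval v φ = 0 ∧
        ∑ i : Fin 3, S i * MvPolynomial.eval v (MvPolynomial.pderiv i φ) = 0}.Finite ∧
    {x : Projectivization F (Fin 3 → F) | ∃ (v : Fin 3 → F) (hv : v ≠ 0),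
        x = Projectivization.mk F v hv ∧ MvPolynomial.eval v φ = 0 ∧
        ∑ i : Fin 3, S i * MvPolynomial.eval v (MvPolynomial.pderiv i φ) = 0}.ncard ≤ 6 := by
  classical
  obtain ⟨M, hdet, hMR, hMS⟩ := exists_frame hR S
  have hMe : M.mulVec ![0, 0, 1] = R := by
    ext i
    simp [Matrix.mulVec, dotProduct, Fin.sum_univ_three, hMR]
  obtain ⟨q, c, hqc⟩ : ∃ q c, bind₁ M.toMvPolynomial φ = singularCubic q c := by
    refine IsHomogeneous.exists_eq_singularCubic ?_ ?_ fun j => ?_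
    · simpa using hφ.aeval M.toMvPolynomial M.toMvPolynomial_isHomogeneous
    · rw [eval_bind₁_toMvPolynomial, hMe, hRγ]
    · rw [eval_pderiv_bind₁_toMvPolynomial, hMe]
      simp [hRsing]
  let ι := algebraMap F (AlgebraicClosure F)
  have hirr' : Irreducible (singularCubic (fun i => ι (q i)) (fun i => ι (c i))) := by
    rw [← map_singularCubic, ← hqc, map_bind₁]
    have : (fun i => map ι (M.toMvPolynomial i)) = (M.map ι).toMvPolynomial := by
      ext1 i
      rw [Matrix.toMvPolynomial_map]
    rw [this]
    refine bind₁_toMvPolynomial_irreducible ?_ hirr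
    rw [← RingHom.mapMatrix_apply, ← RingHom.map_det]
    exact hdet.map ι
  have hcop : ∀ x y, binaryQuadratic q x y = 0 → binaryCubic c x y = 0 → x = 0 ∧ y = 0 := by
    intro x y hx hy
    have h := eq_zero_of_irreducible_singularCubic hirr' (x := ι x) (y := ι y)
      (by simpa [binaryQuadratic] using congrArg ι hx)
      (by simpa [binaryCubic] using congrArg ι hy)
    simpa using h
  obtain ⟨T, hT, hTw⟩ : ∃ T : Finset (Fin 3 → F), T.card ≤ 6 ∧ ∀ w : Fin 3 → F,
      eval (M.mulVec w) φ = 0 → ∑ i, S i * eval (M.mulVec w) (pderiv i φ) = 0 →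
      ∃ a ∈ T, ∃ k : F, w = k • a := by
    rcases hMS with hMS | ⟨s, rfl⟩
    · have hG : polarQuartic q c ≠ 0 := by
        intro h
        have h' : polarQuartic (fun i => ι (q i)) (fun i => ι (c i)) = 0 := by
          ext i
          simp [map_polarQuartic, h]
        obtain ⟨x, y, hx, hy, hxy⟩ := exists_common_zero_of_polarQuartic_eq_zero
          (by rw [← map_ofNat ι 2]; exact (map_ne_zero ι).2 h2)
          (by rw [← map_ofNat ι 3]; exact (map_ne_zero ι).2 h3) h'
        exact hxy (eq_zero_of_irreducible_singularCubic hirr' hx hy)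
      obtain ⟨T, hT, h⟩ := exists_finset_of_polarQuartic_ne_zero hcop hG
      refine ⟨T, hT, fun w hw hw' => h w ?_ ?_⟩
      · rw [← hqc, eval_bind₁_toMvPolynomial, hw]
      · rw [← hqc, eval_pderiv_bind₁_toMvPolynomial]
        simpa [hMS] using hw'
    · have hs : s ≠ 0 := by
        rintro rfl
        simp at hS
      refine ⟨{![0, 0, 1]}, by simp, fun w hw hw' => ⟨_, Finset.mem_singleton_self _, w 2, ?_⟩⟩
      have hq : binaryQuadratic q (w 0) (w 1) = 0 := by
        rw [← eval_pderiv_two_singularCubic q c w, ← hqc, eval_pderiv_bind₁_toMvPolynomial]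
        simpa [hMR, mul_assoc, ← Finset.mul_sum, hs] using hw'
      have hc : binaryCubic c (w 0) (w 1) = 0 := by
        rw [← eval_bind₁_toMvPolynomial, hqc, eval_singularCubic, hq] at hw
        simpa using hw
      obtain ⟨h0, h1⟩ := hcop _ _ hq hc
      ext i
      fin_cases i <;> simp [h0, h1]
  refine Projectivization.ncard_le_of_forall_mem_smul (T := T.image M.mulVec)
    (Finset.card_image_le.trans hT) ?_
  rintro x ⟨v, hv, rfl, hv0, hv1⟩
  obtain ⟨r, hr⟩ := Projectivization.exists_smul_eq_mk_rep F v hv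
  have hMv : M.mulVec (M⁻¹.mulVec v) = v := by
    rw [Matrix.mulVec_mulVec, Matrix.mul_nonsing_inv M hdet, Matrix.one_mulVec]
  obtain ⟨a, ha, k, hk⟩ := hTw (M⁻¹.mulVec v) (by rwa [hMv]) (by rwa [hMv])
  refine ⟨M.mulVec a, Finset.mem_image_of_mem _ ha, r * k, ?_⟩
  rw [← hr, mul_smul, ← Matrix.mulVec_smul, ← hk, hMv, Units.smul_def]
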